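/- arXiv:1801.04512 — 2 statements merged into one kernel-verified Lean document; each statement's English description precedes it below -/
import Mathlib

section
/- Let n ≥ 1, let h be an n×n real symmetric positive definite matrix, let ξ ∈ ℝⁿ be nonzero, let P > 0 and g⁰⁰ > 0 be real numbers with g⁰⁰ ≠ 1, and set a = √(ξᵀhξ)/√(g⁰⁰) (so a > 0). Define the (n+1)×(n+1) matrix B'(X) with entries in ℂ[X], indexed by 0,…,n, by: B'₀₀ = X; B'₀ⱼ = −2P·(hξ)ⱼ (a constant polynomial) for 1 ≤ j ≤ n; B'ⱼ₀ = (1/(2P))·ξⱼ for 1 ≤ j ≤ n; B'ⱼⱼ = X for 1 ≤ j ≤ n; and all other entries 0. If complex numbers C₀, C₁, …, C_n satisfy, for every β ∈ {0,1,…,n}, that (X − i·a) divides Σ_{r=0}^{n} C_r·B'_{rβ}(X) in ℂ[X], then C₀ = C₁ = ⋯ = C_n = 0. -/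
open Polynomial Matrix

/-- The principal part `B'(X)` of the boundary operator from (5.5):
`B'₀₀ = X`, `B'₀ⱼ = −2P·(hξ)ⱼ`, `B'ⱼ₀ = ξⱼ/(2P)`, `B'ⱼⱼ = X` (1 ≤ j ≤ n), 0 otherwise.
Here `v` stands for the vector `hξ`. -/
noncomputable def Bprime (n : ℕ) (P : ℝ) (v ξ : Fin n → ℝ) :
    Fin (n + 1) → Fin (n + 1) → Polynomial ℂ := fun r β =>
  Fin.cases
    (Fin.cases X (fun j => C ((-2 * P * v j : ℝ) : ℂ)) β)
    (fun i => Fin.cases (C ((ξ i / (2 * P) : ℝ) : ℂ))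
      (fun j => if i = j then X else 0) β) r

/-- Linear independence modulo `(X − ia)` of the rows of `B'`: if `(X − ia)` divides
`Σ_r C_r B'_{rβ}(X)` for every `β`, then all `C_r` vanish. -/
theorem stmt4 (n : ℕ) (hn : 1 ≤ n) (h : Matrix (Fin n) (Fin n) ℝ)
    (hsymm : h.IsSymm) (hpd : h.PosDef) (ξ : Fin n → ℝ) (hξ : ξ ≠ 0)
    (P g00 : ℝ) (hP : 0 < P) (hg : 0 < g00) (hg1 : g00 ≠ 1)
    (a : ℝ) (ha : a = Real.sqrt (ξ ⬝ᵥ h.mulVec ξ) / Real.sqrt g00)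
    (c : Fin (n + 1) → ℂ)
    (hdvd : ∀ β : Fin (n + 1),
      (X - C (Complex.I * (a : ℂ))) ∣
        ∑ r : Fin (n + 1), C (c r) * Bprime n P (h.mulVec ξ) ξ r β) :
    ∀ r, c r = 0 := by
  set q := ξ ⬝ᵥ h.mulVec ξ with hq
  have hq_pos : 0 < q := by simpa using hpd.dotProduct_mulVec_pos hξ
  have ha_sq : a ^ 2 * g00 = q := by
    rw [ha, div_pow, Real.sq_sqrt hq_pos.le, Real.sq_sqrt hg.le, div_mul_cancel₀ _ hg.ne']
  have ha_ne : (a : ℂ) ≠ 0 := by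
    rw [Complex.ofReal_ne_zero]
    rintro rfl
    simp [hq_pos.ne] at ha_sq
  have hP_ne : (P : ℂ) ≠ 0 := Complex.ofReal_ne_zero.mpr hP.ne'
  have hz : Complex.I * (a : ℂ) ≠ 0 := mul_ne_zero Complex.I_ne_zero ha_ne
  have heval (β : Fin (n + 1)) :
      ∑ r, c r * (Bprime n P (h.mulVec ξ) ξ r β).eval (Complex.I * (a : ℂ)) = 0 := by
    simpa [IsRoot, eval_finsetSum] using dvd_iff_isRoot.mp (hdvd β)
  have hzero : c 0 * (Complex.I * a) + ∑ j, c j.succ * (ξ j / (2 * P)) = 0 := by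
    simpa [Bprime, Fin.sum_univ_succ] using heval 0
  have hsucc (j : Fin n) :
      c j.succ * (Complex.I * a) = c 0 * (2 * P * (h.mulVec ξ j : ℝ)) := by
    have := heval j.succ
    simp only [Bprime, Fin.sum_univ_succ, Fin.cases_zero, Fin.cases_succ, eval_C, apply_ite,
      eval_X, eval_zero, mul_zero, Finset.sum_ite_eq', Finset.mem_univ, if_true] at this
    push_cast at this
    linear_combination this
  have hsum : (∑ j, c j.succ * (ξ j / (2 * P))) * (Complex.I * a) = c 0 * q := by
    rw [hq, dotProduct, Complex.ofReal_sum, Finset.sum_mul, Finset.mul_sum]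
    refine Finset.sum_congr rfl fun j _ => ?_
    rw [mul_right_comm, hsucc]
    push_cast
    field_simp
  have hc0 : c 0 = 0 := by
    have hprod : c 0 * ((q - a ^ 2 : ℝ) : ℂ) = 0 := by
      push_cast
      linear_combination Complex.I * a * hzero - hsum - c 0 * a ^ 2 * Complex.I_sq
    refine (mul_eq_zero.mp hprod).resolve_right (Complex.ofReal_ne_zero.mpr ?_)
    rw [← ha_sq, ← mul_sub_one]
    exact mul_ne_zero (pow_ne_zero 2 (Complex.ofReal_ne_zero.mp ha_ne)) (sub_ne_zero.mpr hg1)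
  refine Fin.cases hc0 fun j => ?_
  exact (mul_eq_zero.mp ((hsucc j).trans (by rw [hc0, zero_mul]))).resolve_right hz
end

section
/- Let n ≥ 1, let h be an n×n real symmetric positive definite matrix, let ξ ∈ ℝⁿ be nonzero, let P > 0 and g⁰⁰ > 0 be real numbers with g⁰⁰ ≠ 1, and set a = √(ξᵀhξ)/√(g⁰⁰). Define the (n+1)×(n+1) matrix B'(X) with entries in ℂ[X], indexed by 0,…,n, by: B'₀₀ = X; B'₀ⱼ = −2P·(hξ)ⱼ for 1 ≤ j ≤ n; B'ⱼ₀ = (1/(2P))·ξⱼ for 1 ≤ j ≤ n; B'ⱼⱼ = X for 1 ≤ j ≤ n; and all other entries 0. Define Q_{rβ}(X) = B'_{rβ}(X)·(g⁰⁰·X² + ξᵀhξ)^n. If complex numbers C₀, C₁, …, C_n satisfy, for every β ∈ {0,1,…,n}, that (X − i·a)^{n+1} divides Σ_{r=0}^{n} C_r·Q_{rβ}(X) in ℂ[X], then C₀ = C₁ = ⋯ = C_n = 0. -/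
open Polynomial Matrix

/-- If `(X - w)^(n+1)` divides `F · (g X² + q)^n`, where `w ≠ 0` is a root of `g X² + q` and
`g ≠ 0`, then `w` is a root of `F`: the other root `-w` of the quadratic differs from `w`. -/
theorem isRoot_of_pow_succ_dvd_mul_quadratic_pow {K : Type*} [Field K] [CharZero K] {n : ℕ}
    {w g q : K} (hw : w ≠ 0) (hg : g ≠ 0) (hq : g * w ^ 2 + q = 0) {F : K[X]}
    (hF : (X - C w) ^ (n + 1) ∣ F * (C g * X ^ 2 + C q) ^ n) : F.eval w = 0 := by
  have hfactor : C g * X ^ 2 + C q = (X - C w) * (C g * (X + C w)) := by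
    rw [eq_neg_of_add_eq_zero_right hq]
    simp only [map_neg, map_mul, map_pow]
    ring
  rw [hfactor, mul_pow, mul_left_comm, pow_succ] at hF
  have hdvd := (mul_dvd_mul_iff_left (pow_ne_zero n (X_sub_C_ne_zero w))).mp hF
  have hroot := dvd_iff_isRoot.mp hdvd
  simp only [IsRoot.def, eval_mul, eval_pow, eval_add, eval_C, eval_X] at hroot
  exact (mul_eq_zero.mp hroot).resolve_right
    (pow_ne_zero n (mul_ne_zero hg (by simpa [← two_mul] using hw)))

/-- The complementing condition of Lemma 5.1: the rows of the matrix
`Q_{rβ}(X) = B'_{rβ}(X)·(g⁰⁰X² + ξᵀhξ)ⁿ` are linearly independent modulo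
`L₀⁺ = (X − ia)^{n+1}`, where `a = |ξ|_h/√g⁰⁰`. -/
theorem stmt5 (n : ℕ) (hn : 1 ≤ n) (h : Matrix (Fin n) (Fin n) ℝ)
    (hsymm : h.IsSymm) (hpd : h.PosDef) (ξ : Fin n → ℝ) (hξ : ξ ≠ 0)
    (P g00 : ℝ) (hP : 0 < P) (hg : 0 < g00) (hg1 : g00 ≠ 1)
    (a : ℝ) (ha : a = Real.sqrt (ξ ⬝ᵥ h.mulVec ξ) / Real.sqrt g00)
    (c : Fin (n + 1) → ℂ)
    (hdvd : ∀ β : Fin (n + 1),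
      (X - C (Complex.I * (a : ℂ))) ^ (n + 1) ∣
        ∑ r : Fin (n + 1), C (c r) *
          (Bprime n P (h.mulVec ξ) ξ r β *
            (C ((g00 : ℂ)) * X ^ 2 + C (((ξ ⬝ᵥ h.mulVec ξ : ℝ) : ℂ))) ^ n)) :
    ∀ r, c r = 0 := by
  set v := h.mulVec ξ
  have hq : 0 < ξ ⬝ᵥ v := by simpa using hpd.dotProduct_mulVec_pos hξ
  have ha0 : a ≠ 0 := by
    rw [ha]
    exact (div_pos (Real.sqrt_pos.mpr hq) (Real.sqrt_pos.mpr hg)).ne'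
  have hqa : ξ ⬝ᵥ v = g00 * a ^ 2 := by
    rw [ha, div_pow, Real.sq_sqrt hq.le, Real.sq_sqrt hg.le, mul_div_cancel₀ _ hg.ne']
  have hw0 : Complex.I * (a : ℂ) ≠ 0 := by simp [ha0]
  have hw2 : (Complex.I * (a : ℂ)) ^ 2 = -(a : ℂ) ^ 2 := by
    rw [mul_pow, Complex.I_sq, neg_one_mul]
  have hP' : (P : ℂ) ≠ 0 := by exact_mod_cast hP.ne'
  have hroot : ∀ β, ∑ r, c r * (Bprime n P v ξ r β).eval (Complex.I * (a : ℂ)) = 0 := by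
    intro β
    have hβ := hdvd β
    simp only [← mul_assoc, ← Finset.sum_mul] at hβ
    have h0 := isRoot_of_pow_succ_dvd_mul_quadratic_pow hw0
      (by exact_mod_cast hg.ne') (by rw [hw2, hqa]; push_cast; ring) hβ
    simpa [eval_finsetSum] using h0
  have hzero := hroot 0
  have hsucc : ∀ j : Fin n,
      c 0 * (-2 * P * v j) + c j.succ * (Complex.I * (a : ℂ)) = 0 := by
    intro j
    simpa [Fin.sum_univ_succ, Bprime, apply_ite (Polynomial.eval _)] using hroot j.succ
  have hzero' : c 0 * (Complex.I * (a : ℂ)) + ∑ j : Fin n, c j.succ * (ξ j / (2 * P)) = 0 := by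
    simpa [Fin.sum_univ_succ, Bprime] using hzero
  have hsum : (∑ j : Fin n, c j.succ * (ξ j / (2 * P))) * (Complex.I * (a : ℂ)) =
      c 0 * ((ξ ⬝ᵥ v : ℝ) : ℂ) := by
    simp only [dotProduct, Complex.ofReal_sum, Complex.ofReal_mul, Finset.sum_mul, Finset.mul_sum]
    refine Finset.sum_congr rfl fun j _ => ?_
    field_simp
    linear_combination (ξ j : ℂ) * hsucc j
  have hprod : c 0 * ((a : ℂ) ^ 2 * (g00 - 1)) = 0 := by
    rw [hqa] at hsum
    push_cast at hsum
    linear_combination (Complex.I * (a : ℂ)) * hzero' - hsum - c 0 * hw2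
  have hc0 : c 0 = 0 := by
    refine (mul_eq_zero.mp hprod).resolve_right (mul_ne_zero ?_ ?_)
    · exact_mod_cast pow_ne_zero 2 ha0
    · exact_mod_cast sub_ne_zero.mpr hg1
  refine Fin.cases hc0 fun j => ?_
  have hj := hsucc j
  rw [hc0, zero_mul, zero_add] at hj
  exact (mul_eq_zero.mp hj).resolve_right hw0
end
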